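/- (Szemerédi's theorem) Let C ⊆ ℕ have positive upper density, i.e., limsup_{N→∞} |C ∩ {1,…,N}|/N > 0. Then C contains arbitrarily long arithmetic progressions: for every k ∈ ℕ there exist a, n ∈ ℕ such that a, a+n, a+2n, …, a+kn all belong to C. -/

import Mathlib

open Filter
open scoped Classical

/-- The upper density of a set `C ⊆ ℕ`:
`limsup_{N→∞} |C ∩ {1,…,N}| / N`. -/
noncomputable def upperDensity (C : Set ℕ) : ℝ :=
  limsup (fun N : ℕ => (((Finset.Icc 1 N).filter (fun n => n ∈ C)).card : ℝ) / N) atTop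

open Combinatorics

/-! ### Averages and densities on finite types -/

/-- The average of a real function on a finite type. -/
noncomputable def avg {X : Type*} (f : X → ℝ) : ℝ := (∑ᶠ x, f x) / Nat.card X

/-- The density of a subset of a finite type. -/
noncomputable def dens {X : Type*} (A : Set X) : ℝ := avg (A.indicator fun _ => 1)

section avg

variable {X Y : Type*}

theorem avg_eq_sum [Fintype X] (f : X → ℝ) : avg f = (∑ x, f x) / Fintype.card X := by
  rw [avg, finsum_eq_sum_of_fintype, Nat.card_eq_fintype_card]

theorem avg_mono [Finite X] {f g : X → ℝ} (h : ∀ x, f x ≤ g x) : avg f ≤ avg g := by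
  cases nonempty_fintype X
  rw [avg_eq_sum, avg_eq_sum]
  gcongr
  exact h _

theorem avg_add [Finite X] (f g : X → ℝ) : avg (fun x => f x + g x) = avg f + avg g := by
  cases nonempty_fintype X
  simp only [avg_eq_sum, Finset.sum_add_distrib, add_div]

theorem avg_sub [Finite X] (f g : X → ℝ) : avg (fun x => f x - g x) = avg f - avg g := by
  cases nonempty_fintype X
  simp only [avg_eq_sum, Finset.sum_sub_distrib, sub_div]

theorem avg_const_mul [Finite X] (c : ℝ) (f : X → ℝ) : avg (fun x => c * f x) = c * avg f := by
  cases nonempty_fintype X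
  simp only [avg_eq_sum, ← Finset.mul_sum, mul_div_assoc]

theorem avg_const [Finite X] [Nonempty X] (c : ℝ) : avg (fun _ : X => c) = c := by
  cases nonempty_fintype X
  have : (Fintype.card X : ℝ) ≠ 0 := by exact_mod_cast Fintype.card_ne_zero
  simp only [avg_eq_sum, Finset.sum_const, Finset.card_univ, nsmul_eq_mul]
  field_simp

theorem avg_zero : avg (fun _ : X => 0) = 0 := by
  simp [avg]

theorem avg_nonneg [Finite X] {f : X → ℝ} (h : ∀ x, 0 ≤ f x) : 0 ≤ avg f :=
  avg_zero.symm.le.trans (avg_mono h)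

theorem avg_le_of_le [Finite X] [Nonempty X] {f : X → ℝ} {c : ℝ} (h : ∀ x, f x ≤ c) :
    avg f ≤ c :=
  (avg_mono h).trans_eq (avg_const c)

theorem avg_equiv (e : X ≃ Y) (f : Y → ℝ) : avg (fun x => f (e x)) = avg f := by
  rw [avg, avg, Nat.card_congr e, finsum_comp_equiv]

theorem avg_prod [Finite X] [Finite Y] (f : X × Y → ℝ) :
    avg f = avg fun x => avg fun y => f (x, y) := by
  cases nonempty_fintype X
  cases nonempty_fintype Y
  simp only [avg_eq_sum, Fintype.sum_prod_type, Fintype.card_prod, Nat.cast_mul,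
    ← Finset.sum_div, div_div, mul_comm]

theorem avg_comm [Finite X] [Finite Y] (f : X → Y → ℝ) :
    (avg fun x => avg fun y => f x y) = avg fun y => avg fun x => f x y := by
  rw [← avg_prod fun p : X × Y => f p.1 p.2, ← avg_prod fun p : Y × X => f p.2 p.1,
    ← avg_equiv (Equiv.prodComm X Y)]
  rfl

theorem avg_sumElim {ι κ β : Type*} [Finite ι] [Finite κ] [Finite β] (f : (ι ⊕ κ → β) → ℝ) :
    avg f = avg fun x => avg fun y => f (Sum.elim x y) := by
  rw [← avg_equiv (Equiv.sumArrowEquivProdArrow ι κ β).symm, avg_prod]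
  rfl

theorem avg_prod_apply {ι β : Type*} [Fintype ι] [Finite β] (φ : β → ℝ) :
    avg (fun x : ι → β => ∏ i, φ (x i)) = avg φ ^ Fintype.card ι := by
  cases nonempty_fintype β
  rw [avg_eq_sum, avg_eq_sum, div_pow, Fintype.card_fun, Nat.cast_pow]
  have h : (∑ b, φ b) ^ Fintype.card ι = ∏ _i : ι, ∑ b, φ b := by simp
  rw [h, Finset.prod_univ_sum, Fintype.piFinset_univ]

theorem exists_le_avg_fiber {Z : Type*} [Finite X] {f : X → ℝ} {c : ℝ} [Nonempty X]
    (h : c ≤ avg f) (p : X → Z) :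
    ∃ z, Nonempty {x // p x = z} ∧ c ≤ avg fun x : {x // p x = z} => f x := by
  cases nonempty_fintype X
  have hX : (0 : ℝ) < Fintype.card X := by exact_mod_cast Fintype.card_pos
  rw [avg_eq_sum, le_div_iff₀ hX] at h
  by_contra! hcon
  have key : ∀ z ∈ Finset.univ.image p,
      ∑ x with p x = z, f x < ∑ x with p x = z, c := by
    intro z hz
    obtain ⟨x, -, hx⟩ := Finset.mem_image.1 hz
    have hne : Nonempty {x // p x = z} := ⟨⟨x, hx⟩⟩
    have h1 := hcon z hne
    have h2 : (0 : ℝ) < Fintype.card {x // p x = z} := by exact_mod_cast Fintype.card_pos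
    rw [avg_eq_sum, div_lt_iff₀ h2] at h1
    rw [Finset.sum_const, nsmul_eq_mul, ← Finset.sum_subtype_eq_sum_filter,
      ← Fintype.card_subtype, mul_comm]
    simpa using h1
  have := Finset.sum_lt_sum_of_nonempty (Finset.univ_nonempty.image p) key
  rw [Finset.sum_fiberwise_of_maps_to (fun x _ => Finset.mem_image_of_mem p (Finset.mem_univ x)),
    Finset.sum_fiberwise_of_maps_to (fun x _ => Finset.mem_image_of_mem p (Finset.mem_univ x)),
    Finset.sum_const, nsmul_eq_mul, Finset.card_univ] at this
  linarith

theorem dens_mono [Finite X] {A B : Set X} (h : A ⊆ B) : dens A ≤ dens B :=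
  avg_mono fun x => Set.indicator_le_indicator_of_subset h (fun _ => zero_le_one) x

theorem dens_nonneg [Finite X] (A : Set X) : 0 ≤ dens A :=
  avg_nonneg fun _ => Set.indicator_nonneg (fun _ _ => zero_le_one) _

theorem dens_le_one [Finite X] [Nonempty X] (A : Set X) : dens A ≤ 1 :=
  avg_le_of_le fun _ => Set.indicator_le_self' (fun _ _ => zero_le_one) _

theorem dens_compl [Finite X] [Nonempty X] (A : Set X) : dens Aᶜ = 1 - dens A := by
  rw [eq_sub_iff_add_eq, dens, dens, ← avg_add]
  refine Eq.trans ?_ (avg_const (X := X) 1)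
  congr 1
  ext x
  by_cases h : x ∈ A <;> simp [h]

theorem dens_iUnion_le {L : Type*} [Finite X] [Fintype L] (E : L → Set X) :
    dens (⋃ l, E l) ≤ ∑ l, dens (E l) := by
  cases nonempty_fintype X
  simp only [dens, avg_eq_sum, ← Finset.sum_div]
  rw [Finset.sum_comm]
  gcongr with x
  have h0 : ∀ l ∈ Finset.univ, 0 ≤ (E l).indicator (fun _ => (1 : ℝ)) x :=
    fun _ _ => Set.indicator_nonneg (fun _ _ => zero_le_one) _
  by_cases h : x ∈ ⋃ l, E l
  · obtain ⟨l, hl⟩ := Set.mem_iUnion.1 h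
    refine le_trans ?_ (Finset.single_le_sum h0 (Finset.mem_univ l))
    simp [h, hl]
  · rw [Set.indicator_of_notMem h]
    exact Finset.sum_nonneg h0

/-- If the fibres of a dense relation `A` that are dense contain one of finitely many sets `T l`,
then some `T l` is contained in a positive proportion of the fibres. -/
theorem exists_dense_fibers {L : Type*} [Finite X] [Finite Y] [Nonempty X] [Nonempty Y] [Finite L]
    {A : X → Y → Prop} {c : ℝ} (hc : 0 < c) (hA : c ≤ avg fun y => dens {x | A x y})
    (T : L → Set X) (h : ∀ y, c / 2 ≤ dens {x | A x y} → ∃ l, ∀ x ∈ T l, A x y) :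
    ∃ l, c / 2 / (Nat.card L + 1) ≤ dens {y | ∀ x ∈ T l, A x y} := by
  cases nonempty_fintype L
  set S : Set Y := {y | c / 2 ≤ dens {x | A x y}}
  have h1 : avg (fun y => dens {x | A x y}) ≤ dens S + c / 2 := by
    rw [← avg_const (X := Y) (c / 2), dens, ← avg_add]
    refine avg_mono fun y => ?_
    by_cases hy : y ∈ S
    · simp only [hy, Set.indicator_of_mem]
      have := dens_le_one {x | A x y}
      linarith
    · simp only [hy, not_false_eq_true, Set.indicator_of_notMem, zero_add]
      exact (not_le.1 hy).le
  have h2 : dens S ≤ ∑ l, dens {y | ∀ x ∈ T l, A x y} := by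
    refine le_trans (dens_mono fun y hy => ?_) (dens_iUnion_le _)
    exact Set.mem_iUnion.2 (h y hy)
  by_contra! hcon
  have h3 := Finset.sum_le_sum fun l (_ : l ∈ Finset.univ) => (hcon l).le
  rw [Finset.sum_const, Finset.card_univ, nsmul_eq_mul, Nat.card_eq_fintype_card] at h3
  have h4 : (Fintype.card L : ℝ) * (c / 2 / (Fintype.card L + 1)) < c / 2 := by
    rw [mul_div_assoc', div_lt_iff₀ (by positivity)]
    linarith
  linarith

theorem dens_preimage_equiv (e : X ≃ Y) (A : Set Y) : dens (e ⁻¹' A) = dens A :=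
  avg_equiv e (A.indicator fun _ => 1)

theorem dens_sumElim {ι κ β : Type*} [Finite ι] [Finite κ] [Finite β] (A : Set (ι ⊕ κ → β)) :
    dens A = avg fun x => dens {y | Sum.elim x y ∈ A} :=
  avg_sumElim _

theorem dens_sumElim' {ι κ β : Type*} [Finite ι] [Finite κ] [Finite β] (A : Set (ι ⊕ κ → β)) :
    dens A = avg fun y => dens {x | Sum.elim x y ∈ A} :=
  (avg_sumElim _).trans (avg_comm _)

theorem avg_indicator_le_dens [Finite X] {g : X → ℝ} (h : ∀ x, g x ≤ 1) (A : Set X) :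
    avg (A.indicator g) ≤ dens A :=
  avg_mono fun _ => Set.indicator_le_indicator (h _)

theorem avg_indicator_range [Finite X] [Finite Y] [Nonempty Y] {F : Y → X}
    (hF : Function.Injective F) (g : X → ℝ) :
    avg ((Set.range F).indicator g) = Nat.card Y / Nat.card X * avg fun y => g (F y) := by
  have h : ∑ᶠ x, (Set.range F).indicator g x = ∑ᶠ y, g (F y) := by
    rw [← finsum_mem_def, finsum_mem_range hF]
  have hY : (Nat.card Y : ℝ) ≠ 0 := by exact_mod_cast Nat.card_pos.ne'
  rw [avg, avg, h]
  field_simp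

theorem one_div_card_le_dens [Finite X] {A : Set X} (h : A.Nonempty) :
    1 / (Nat.card X : ℝ) ≤ dens A := by
  obtain ⟨x, hx⟩ := h
  refine le_trans (le_of_eq ?_) (dens_mono (Set.singleton_subset_iff.2 hx))
  have : Set.range (fun _ : Unit => x) = {x} := Set.range_const
  rw [dens, ← this, avg_indicator_range (fun _ _ _ => rfl), avg_const]
  simp

theorem avg_lt_one {β : Type*} [Finite β] {φ : β → ℝ} (h : ∀ b, φ b ≤ 1) {b₀ : β}
    (hb₀ : φ b₀ < 1) : avg φ < 1 := by
  cases nonempty_fintype β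
  have : Nonempty β := ⟨b₀⟩
  rw [avg_eq_sum, div_lt_one (by exact_mod_cast Fintype.card_pos)]
  calc ∑ b, φ b < ∑ _b : β, (1 : ℝ) :=
        Finset.sum_lt_sum (fun b _ => h b) ⟨b₀, Finset.mem_univ _, hb₀⟩
    _ = Fintype.card β := by simp

theorem exists_forall_avg_prod_le {β : Type*} [Finite β] {φ : β → ℝ} (h0 : ∀ b, 0 ≤ φ b)
    (h1 : ∀ b, φ b ≤ 1) {b₀ : β} (hb₀ : φ b₀ < 1) {ε : ℝ} (hε : 0 < ε) :
    ∃ N, ∀ (ι : Type) [Fintype ι], N ≤ Nat.card ι →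
      avg (fun x : ι → β => ∏ i, φ (x i)) ≤ ε := by
  obtain ⟨N, hN⟩ := exists_pow_lt_of_lt_one hε (avg_lt_one h1 hb₀)
  refine ⟨N, fun ι _ hι => ?_⟩
  rw [avg_prod_apply]
  rw [Nat.card_eq_fintype_card] at hι
  exact (pow_le_pow_of_le_one (avg_nonneg h0) (avg_lt_one h1 hb₀).le hι).trans hN.le

end avg

/-! ### Operations on combinatorial lines and subspaces -/

namespace Combinatorics

variable {η κ ι α : Type*}

instance Line.instFinite [Finite ι] [Finite α] : Finite (Line α ι) :=
  Finite.of_injective Line.idxFun fun _ _ => Line.ext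

instance Subspace.instFinite [Finite η] [Finite ι] [Finite α] : Finite (Subspace η α ι) :=
  Finite.of_injective Subspace.idxFun fun _ _ => Subspace.ext

namespace Subspace

/-- Distinct points of the parameter cube have distinct images in a subspace. -/
theorem apply_injective (V : Subspace η α ι) : Function.Injective V := by
  intro x y h
  ext e
  obtain ⟨i, hi⟩ := V.proper e
  simpa [apply_inr hi] using congr_fun h i

/-- A subspace of a subspace. -/
def comp (V : Subspace η α ι) (W : Subspace κ α η) : Subspace κ α ι where
  idxFun i := (V.idxFun i).elim Sum.inl W.idxFun
  proper e := by
    obtain ⟨j, hj⟩ := W.proper e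
    obtain ⟨i, hi⟩ := V.proper j
    exact ⟨i, by simp [hi, hj]⟩

theorem comp_apply (V : Subspace η α ι) (W : Subspace κ α η) (x : κ → α) :
    V.comp W x = V (W x) := by
  ext i
  simp only [apply_def, comp]
  cases V.idxFun i <;> simp [apply_def]

/-- A line in a subspace. -/
def compLine (V : Subspace η α ι) (l : Line α η) : Line α ι where
  idxFun i := (V.idxFun i).elim some l.idxFun
  proper := by
    obtain ⟨j, hj⟩ := l.proper
    obtain ⟨i, hi⟩ := V.proper j
    exact ⟨i, by simp [hi, hj]⟩

theorem compLine_apply (V : Subspace η α ι) (l : Line α η) (a : α) :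
    V.compLine l a = V (l a) := by
  ext i
  simp only [apply_def, compLine, Line.coe_apply]
  cases V.idxFun i <;> simp

/-- The product of a subspace with a point. -/
def horizontal (V : Subspace η α ι) (y : κ → α) : Subspace η α (ι ⊕ κ) where
  idxFun := Sum.elim V.idxFun fun j => Sum.inl (y j)
  proper e := by
    obtain ⟨i, hi⟩ := V.proper e
    exact ⟨Sum.inl i, by simp [hi]⟩

theorem horizontal_apply (V : Subspace η α ι) (y : κ → α) (x : η → α) :
    V.horizontal y x = Sum.elim (V x) y := by
  ext (i | i) <;> simp [apply_def, horizontal]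

/-- The product of a point with a subspace. -/
def vertical (x : κ → α) (V : Subspace η α ι) : Subspace η α (κ ⊕ ι) where
  idxFun := Sum.elim (fun j => Sum.inl (x j)) V.idxFun
  proper e := by
    obtain ⟨i, hi⟩ := V.proper e
    exact ⟨Sum.inr i, by simp [hi]⟩

theorem vertical_apply (x : κ → α) (V : Subspace η α ι) (y : η → α) :
    V.vertical x y = Sum.elim x (V y) := by
  ext (i | i) <;> simp [apply_def, vertical]

/-- The subspace over the alphabet `Option α` given by the same word as a subspace over `α`. -/
def extend (V : Subspace η α ι) : Subspace η (Option α) ι where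
  idxFun i := (V.idxFun i).map some id
  proper e := by
    obtain ⟨i, hi⟩ := V.proper e
    exact ⟨i, by simp [hi]⟩

theorem extend_apply (V : Subspace η α ι) (x : η → Option α) (i : ι) :
    V.extend x i = (V.idxFun i).elim some x := by
  simp only [apply_def, extend]
  cases V.idxFun i <;> simp

end Subspace

/-- The product of a line with a subspace, as a subspace. -/
def Line.prodSubspace {m : ℕ} (l : Line α ι) (V : Subspace (Fin m) α κ) :
    Subspace (Fin (m + 1)) α (ι ⊕ κ) where
  idxFun := Sum.elim (fun i => (l.idxFun i).elim (Sum.inr 0) Sum.inl)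
    fun j => (V.idxFun j).map id Fin.succ
  proper e := by
    refine Fin.cases ?_ (fun e => ?_) e
    · obtain ⟨i, hi⟩ := l.proper
      exact ⟨Sum.inl i, by simp [hi]⟩
    · obtain ⟨j, hj⟩ := V.proper e
      exact ⟨Sum.inr j, by simp [hj]⟩

theorem Line.prodSubspace_apply {m : ℕ} (l : Line α ι) (V : Subspace (Fin m) α κ)
    (x : Fin (m + 1) → α) :
    l.prodSubspace V x = Sum.elim (l (x 0)) (V fun j => x j.succ) := by
  ext (i | j)
  · simp only [Subspace.apply_def, prodSubspace, Sum.elim_inl, Line.coe_apply]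
    cases l.idxFun i <;> simp
  · simp only [Subspace.apply_def, prodSubspace, Sum.elim_inr]
    cases V.idxFun j <;> simp

end Combinatorics

theorem exists_sum_equiv {ι : Type} [Finite ι] {m n : ℕ} (h : m + n ≤ Nat.card ι) :
    ∃ k, n ≤ k ∧ Nonempty (Fin m ⊕ Fin k ≃ ι) := by
  refine ⟨Nat.card ι - m, by omega, ⟨finSumFinEquiv.trans ?_⟩⟩
  exact (finCongr (by omega)).trans (Finite.equivFin ι).symm

/-! ### A Ramsey theorem for combinatorial lines

A line over the alphabet `α` is a word over `Option α` in which `none`, the variable, occurs. -/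

namespace Combinatorics

variable {η κ ι α : Type*}

theorem Subspace.extend_comp_apply (V : Subspace η α ι) (W : Subspace κ α η)
    (x : κ → Option α) : (V.comp W).extend x = V.extend (W.extend x) := by
  ext1 i
  simp only [extend_apply, comp]
  cases V.idxFun i <;> simp [extend_apply]

theorem Line.exists_mono_fin (α κ : Type*) [Finite α] [Finite κ] :
    ∃ N, ∀ C : (Fin N → α) → κ, ∃ l : Line α (Fin N), l.IsMono C := by
  obtain ⟨ι, _, hι⟩ := Line.exists_mono_in_high_dimension α κ
  refine ⟨Fintype.card ι, fun C => ?_⟩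
  obtain ⟨l, c, hl⟩ := hι fun v => C (v ∘ (Fintype.equivFin ι).symm)
  obtain ⟨i, hi⟩ := l.proper
  exact ⟨⟨l.idxFun ∘ (Fintype.equivFin ι).symm, Fintype.equivFin ι i, by simpa using hi⟩, c, hl⟩

/-- The colour of a word with a variable depends only on the part of the word that precedes some
occurrence of the variable. -/
def DependsOnPrefix {n : ℕ} (C : (Fin n → Option α) → κ) : Prop :=
  ∀ j w w', w j = none → w' j = none → (∀ i < j, w i = w' i) → C w = C w'

theorem exists_subspace_dependsOnPrefix (α : Type) [Finite α] (n : ℕ) :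
    ∀ (κ : Type) [Finite κ], ∃ (ι : Type) (_ : Finite ι), ∀ C : (ι → Option α) → κ,
      ∃ V : Subspace (Fin n) α ι, DependsOnPrefix fun w => C (V.extend w) := by
  induction n with
  | zero =>
    exact fun κ _ => ⟨Empty, inferInstance, fun C =>
      ⟨⟨Empty.elim, fun e => e.elim0⟩, fun j => j.elim0⟩⟩
  | succ n ih =>
    intro κ _
    obtain ⟨η, _, hη⟩ := ih (α → κ)
    obtain ⟨I, _, hI⟩ := Subspace.exists_mono_in_high_dimension (Option α) κ η
    refine ⟨Option I, inferInstance, fun C => ?_⟩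
    obtain ⟨U, c, hU⟩ := hI fun u => C fun i => i.elim none u
    let W : Subspace (Option η) α (Option I) :=
      { idxFun := fun i => i.elim (Sum.inr none) fun i =>
          (U.idxFun i).elim (fun a => a.elim (Sum.inr none) Sum.inl) fun e => Sum.inr (some e)
        proper := by
          rintro (_ | e)
          · exact ⟨none, rfl⟩
          · obtain ⟨i, hi⟩ := U.proper e
            exact ⟨some i, by simp [hi]⟩ }
    have hW : ∀ w : Option η → Option α, w none = none → C (W.extend w) = c := by
      intro w hw
      rw [← hU fun e => w (some e)]
      congr 1
      ext1 (_ | i)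
      · simp [Subspace.extend_apply, W, hw]
      · rw [Subspace.extend_apply]
        simp only [W, Option.elim_some, Subspace.apply_def]
        rcases U.idxFun i with (_ | a) | e <;> simp [hw]
    obtain ⟨V, hV⟩ := hη fun v a => C (W.extend fun e => e.elim (some a) v)
    let V' : Subspace (Fin (n + 1)) α (Option η) :=
      { idxFun := fun i => i.elim (Sum.inr 0) fun e => (V.idxFun e).map id Fin.succ
        proper := by
          refine Fin.cases ⟨none, rfl⟩ fun j => ?_
          obtain ⟨e, he⟩ := V.proper j
          exact ⟨some e, by simp [he]⟩ }
    have hV' : ∀ w : Fin (n + 1) → Option α,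
        V'.extend w = fun e => e.elim (w 0) (V.extend fun j => w j.succ) := by
      intro w
      ext1 (_ | e)
      · simp [Subspace.extend_apply, V']
      · simp only [Subspace.extend_apply, V', Option.elim_some]
        cases V.idxFun e <;> simp
    refine ⟨W.comp V', fun j w w' hj hj' hjj' => ?_⟩
    simp only [Subspace.extend_comp_apply, hV']
    rcases hw : w 0 with _ | a
    · have hw' : w' 0 = none := by
        rcases Fin.eq_zero_or_eq_succ j with rfl | ⟨j, rfl⟩
        · exact hj'
        · rw [← hjj' 0 j.succ_pos, hw]
      rw [hW _ rfl, hW _ hw']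
    · obtain ⟨j, rfl⟩ : ∃ k, j = Fin.succ k := by
        refine Fin.exists_succ_eq.2 ?_ |>.imp fun _ => Eq.symm
        rintro rfl
        simp [hw] at hj
      rw [← hjj' 0 j.succ_pos, hw]
      exact congr_fun (hV j (fun i => w i.succ) (fun i => w' i.succ) hj hj'
        fun i hi => hjj' i.succ (Fin.succ_lt_succ_iff.2 hi)) a

theorem DependsOnPrefix.exists_subspace (α κ : Type) [Finite α] [Nonempty α] [Finite κ] (r : ℕ) :
    ∃ n, ∀ C : (Fin n → Option α) → κ, DependsOnPrefix C →
      ∃ (V : Subspace (Fin r) α (Fin n)) (c : Fin r → κ), ∀ w j, w j = none →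
        (∀ i < j, w i ≠ none) → C (V.extend w) = c j := by
  induction r with
  | zero => exact ⟨0, fun C _ => ⟨⟨fun i => i.elim0, fun e => e.elim0⟩, fun e => e.elim0,
      fun _ j => j.elim0⟩⟩
  | succ r ih =>
    obtain ⟨n, hn⟩ := ih
    obtain ⟨N, hN⟩ := Line.exists_mono_fin α ((Fin n → Option α) → κ)
    refine ⟨N + n, fun C hC => ?_⟩
    obtain ⟨l, c₀, hl⟩ := hN fun u v => C (Fin.append (fun i => some (u i)) v)
    have hc₀ : DependsOnPrefix c₀ := by
      intro j w w' hj hj' hjj'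
      rw [← hl (Classical.arbitrary α)]
      refine hC (Fin.natAdd N j) _ _ (by simpa using hj) (by simpa using hj') fun i hi => ?_
      refine Fin.addCases (fun i _ => ?_) (fun i hi => ?_) i hi
      · simp
      · simpa using hjj' i (by simpa using hi)
    obtain ⟨V, c, hV⟩ := hn c₀ hc₀
    have key : ∀ w : Fin (r + 1) → Option α,
        ((l.prodSubspace V).reindex (Equiv.refl _) (Equiv.refl _) finSumFinEquiv).extend w =
          Fin.append (fun i => (l.idxFun i).elim (w 0) some) (V.extend fun j => w j.succ) := by
      intro w
      ext1 i
      refine Fin.addCases (fun i => ?_) (fun i => ?_) i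
      · simp only [Subspace.extend_apply, Subspace.reindex, Line.prodSubspace,
          finSumFinEquiv_symm_apply_castAdd, Fin.append_left, Sum.elim_inl]
        cases l.idxFun i <;> simp
      · simp only [Subspace.extend_apply, Subspace.reindex, Line.prodSubspace,
          finSumFinEquiv_symm_apply_natAdd, Fin.append_right, Sum.elim_inr]
        cases V.idxFun i <;> simp
    refine ⟨(l.prodSubspace V).reindex (Equiv.refl _) (Equiv.refl _) finSumFinEquiv,
      Fin.cons (C (Fin.append l.idxFun fun _ => none)) c, fun w j hj hlt => ?_⟩
    rw [key]
    rcases Fin.eq_zero_or_eq_succ j with rfl | ⟨j, rfl⟩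
    · obtain ⟨i₀, hi₀⟩ := l.proper
      refine hC (Fin.castAdd n i₀) _ _ (by simp [hi₀, hj]) (by simp [hi₀]) fun i hi => ?_
      refine Fin.addCases (fun i _ => ?_) (fun i hi => ?_) i hi
      · simp only [Fin.append_left, hj]
        cases l.idxFun i <;> simp
      · simp only [Fin.lt_def, Fin.val_natAdd, Fin.val_castAdd] at hi
        omega
    · obtain ⟨a, ha⟩ := Option.ne_none_iff_exists'.1 (hlt 0 j.succ_pos)
      have := congr_fun (hl a) (V.extend fun j => w j.succ)
      rw [Fin.cons_succ, ← hV (fun i => w i.succ) j hj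
        fun i hi => hlt i.succ (Fin.succ_lt_succ_iff.2 hi), ← this]
      congr 2
      ext1 i
      rw [ha, Line.coe_apply]
      cases l.idxFun i <;> simp

/-- For every finite colouring of the words with a variable in high dimension there is a subspace
all of whose words with a variable have the same colour. -/
theorem exists_subspace_mono_lines (α κ η : Type) [Finite α] [Nonempty α] [Finite κ] [Finite η] :
    ∃ (ι : Type) (_ : Finite ι), ∀ C : (ι → Option α) → κ, ∃ (V : Subspace η α ι) (c : κ),
      ∀ w, (∃ e, w e = none) → C (V.extend w) = c := by
  cases nonempty_fintype η
  cases nonempty_fintype κ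
  obtain ⟨n, hn⟩ := DependsOnPrefix.exists_subspace α κ (Fintype.card κ * Fintype.card η + 1)
  obtain ⟨ι, hι, h⟩ := exists_subspace_dependsOnPrefix α n κ
  refine ⟨ι, hι, fun C => ?_⟩
  obtain ⟨V, hV⟩ := h C
  obtain ⟨W, c, hW⟩ := hn _ hV
  obtain ⟨y, hy⟩ := Fintype.exists_lt_card_fiber_of_mul_lt_card c (n := Fintype.card η) (by simp)
  rw [← Fintype.card_subtype] at hy
  obtain ⟨σ⟩ := Function.Embedding.nonempty_of_card_le hy.le
  have hσ : Function.Injective fun e => (σ e).1 :=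
    Subtype.val_injective.comp σ.injective
  let U : Subspace η α (Fin (Fintype.card κ * Fintype.card η + 1)) :=
    { idxFun := fun j => if h : ∃ e, (σ e).1 = j then Sum.inr h.choose
        else Sum.inl (Classical.arbitrary α)
      proper := fun e => ⟨σ e, by
        have h : ∃ e', (σ e').1 = σ e := ⟨e, rfl⟩
        rw [dif_pos h, hσ h.choose_spec]⟩ }
  refine ⟨V.comp (W.comp U), y, fun w ⟨e, he⟩ => ?_⟩
  have hne : ∃ j, U.extend w j = none := by
    obtain ⟨j, hj⟩ := U.proper e
    exact ⟨j, by simp [Subspace.extend_apply, hj, he]⟩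
  obtain ⟨j, hj, hmin⟩ := WellFounded.has_min (wellFounded_lt (α := Fin _))
    {j | U.extend w j = none} hne
  have hlt : ∀ i < j, U.extend w i ≠ none := fun i hi h => hmin i h hi
  rw [Subspace.extend_comp_apply, Subspace.extend_comp_apply, hW _ j hj hlt]
  by_cases h : ∃ e, (σ e).1 = j
  · obtain ⟨e, rfl⟩ := h
    exact (σ e).2
  · simp [Subspace.extend_apply, U, h] at hj

end Combinatorics

/-! ### Insensitive sets -/

/-- The density Hales–Jewett property for the alphabet `α` and the density `δ`. -/
def DensityHJ (α : Type) (δ : ℝ) : Prop :=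
  ∃ n : ℕ, ∀ (ι : Type) [Finite ι], n ≤ Nat.card ι → ∀ A : Set (ι → α), δ ≤ dens A →
    ∃ l : Line α ι, ∀ a, l a ∈ A

theorem nonempty_of_dens_pos {X : Type*} {A : Set X} (h : 0 < dens A) : A.Nonempty := by
  by_contra hA
  rw [Set.not_nonempty_iff_eq_empty.1 hA, dens, Set.indicator_empty, avg_zero] at h
  exact h.false

theorem dens_comp_symm {ι κ α : Type*} (e : κ ≃ ι) (A : Set (ι → α)) :
    dens {x : κ → α | (fun i => x (e.symm i)) ∈ A} = dens A :=
  dens_preimage_equiv (e.arrowCongr (Equiv.refl α)) A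

theorem Combinatorics.Subspace.reindex_refl_apply {η ι κ α : Type*} (V : Subspace η α ι)
    (e : ι ≃ κ) (x : η → α) :
    V.reindex (Equiv.refl _) (Equiv.refl _) e x = fun i => V x (e.symm i) := by
  ext1 i
  rw [Subspace.reindex_apply]
  rfl

/-- The multidimensional form of the density Hales–Jewett property. -/
theorem exists_subspace_of_densityHJ {α : Type} [Finite α] [Nonempty α]
    (h : ∀ δ > 0, DensityHJ α δ) (m : ℕ) : ∀ δ > 0, ∃ n : ℕ, ∀ (ι : Type) [Finite ι],
      n ≤ Nat.card ι → ∀ A : Set (ι → α), δ ≤ dens A →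
        ∃ V : Subspace (Fin m) α ι, ∀ x, V x ∈ A := by
  induction m with
  | zero =>
    intro δ hδ
    refine ⟨0, fun ι _ _ A hA => ?_⟩
    obtain ⟨x, hx⟩ := nonempty_of_dens_pos (hδ.trans_le hA)
    exact ⟨⟨fun i => Sum.inl (x i), fun e => e.elim0⟩, fun _ => hx⟩
  | succ m ih =>
    intro δ hδ
    obtain ⟨n₁, h₁⟩ := h (δ / 2) (by positivity)
    obtain ⟨n₂, h₂⟩ := ih (δ / 2 / (Nat.card (Line α (Fin n₁)) + 1)) (by positivity)
    refine ⟨n₁ + n₂, fun ι _ hι A hA => ?_⟩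
    obtain ⟨k, hk, ⟨e⟩⟩ := exists_sum_equiv hι
    rw [← dens_comp_symm e, dens_sumElim'] at hA
    obtain ⟨l, hl⟩ := exists_dense_fibers hδ hA (fun l : Line α (Fin n₁) => Set.range l)
      fun y hy => by simpa using h₁ (Fin n₁) (by simp) _ hy
    obtain ⟨V, hV⟩ := h₂ (Fin k) (by simpa using hk) _ hl
    refine ⟨(l.prodSubspace V).reindex (Equiv.refl _) (Equiv.refl _) e, fun x => ?_⟩
    rw [Subspace.reindex_refl_apply, Line.prodSubspace_apply]
    exact hV (fun j => x j.succ) (l (x 0)) ⟨_, rfl⟩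

/-- A set of words over `Option α` is insensitive at `a` if membership does not change when
occurrences of `none` are replaced by `some a` or conversely. -/
def Insensitive {α ι : Type*} (a : α) (D : Set (ι → Option α)) : Prop :=
  ∀ x, x ∈ D ↔ (fun i => some ((x i).getD a)) ∈ D

namespace Insensitive

variable {α : Type} {ι κ : Type*} {a : α}

theorem compl {D : Set (ι → Option α)} (h : Insensitive a D) : Insensitive a Dᶜ :=
  fun x => not_congr (h x)

theorem inter {D E : Set (ι → Option α)} (hD : Insensitive a D) (hE : Insensitive a E) :
    Insensitive a (D ∩ E) :=
  fun x => and_congr (hD x) (hE x)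

theorem mem_iff_mem {D : Set (ι → Option α)} (h : Insensitive a D) {x y : ι → Option α}
    (hxy : ∀ i, (x i).getD a = (y i).getD a) : x ∈ D ↔ y ∈ D := by
  rw [h x, h y]
  simp only [hxy]

theorem preimage {D : Set (ι → Option α)} (h : Insensitive a D)
    {F : (κ → Option α) → ι → Option α}
    (hF : ∀ x y, (∀ i, (x i).getD a = (y i).getD a) → ∀ i, (F x i).getD a = (F y i).getD a) :
    Insensitive a {x | F x ∈ D} :=
  fun x => h.mem_iff_mem (hF _ _ fun i => by simp)

theorem preimage_subspace {D : Set (ι → Option α)} (h : Insensitive a D)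
    (V : Subspace κ (Option α) ι) : Insensitive a {x | V x ∈ D} := by
  refine h.preimage fun x y hxy i => ?_
  simp only [Subspace.apply_def]
  cases V.idxFun i <;> simp [hxy]

theorem preimage_reindex {D : Set (ι → Option α)} (h : Insensitive a D) (e : ι → κ) :
    Insensitive a {x : κ → Option α | (fun i => x (e i)) ∈ D} :=
  h.preimage fun _ _ hxy i => hxy (e i)

theorem preimage_sumElim {D : Set (ι ⊕ κ → Option α)} (h : Insensitive a D) (x : ι → Option α) :
    Insensitive a {y | Sum.elim x y ∈ D} := by
  refine h.preimage fun y z hyz i => ?_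
  cases i <;> simp [hyz]

theorem preimage_sumElim' {D : Set (ι ⊕ κ → Option α)} (h : Insensitive a D)
    (y : κ → Option α) : Insensitive a {x | Sum.elim x y ∈ D} := by
  refine h.preimage fun x z hxz i => ?_
  cases i <;> simp [hxz]

/-- Dense insensitive sets over `Option α` contain subspaces if dense sets over `α` do. -/
theorem exists_subspace [Finite α] [Nonempty α] (h : ∀ δ > 0, DensityHJ α δ) (a : α) (m : ℕ)
    {ε : ℝ} (hε : 0 < ε) : ∃ N : ℕ, ∀ (ι : Type) [Finite ι], N ≤ Nat.card ι →
      ∀ D : Set (ι → Option α), Insensitive a D → ε ≤ dens D →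
        ∃ V : Subspace (Fin m) (Option α) ι, ∀ x, V x ∈ D := by
  obtain ⟨n, hn⟩ := exists_subspace_of_densityHJ h m (ε / 2) (by positivity)
  let φ : Option α → ℝ := fun b => if b = none then 1 else 1 / 2
  obtain ⟨N, hN⟩ := exists_forall_avg_prod_le (φ := φ)
    (fun b => by dsimp only [φ]; split_ifs <;> norm_num)
    (fun b => by dsimp only [φ]; split_ifs <;> norm_num) (b₀ := some a)
    (by dsimp only [φ]; rw [if_neg (Option.some_ne_none a)]; norm_num)
    (ε := ε / 2 * (1 / 2) ^ n) (by positivity)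
  refine ⟨N, fun ι _ hι D hD hDε => ?_⟩
  cases nonempty_fintype ι
  let p : (ι → Option α) → Finset ι := fun x => Finset.univ.filter fun i => x i ≠ none
  let few : Set (ι → Option α) := {x | (p x).card < n}
  have hfew : dens few ≤ ε / 2 := by
    have h1 : (1 / 2) ^ n * dens few ≤ avg fun x : ι → Option α => ∏ i, φ (x i) := by
      rw [dens, ← avg_const_mul]
      refine avg_mono fun x => ?_
      have hx : ∏ i, φ (x i) = (1 / 2) ^ (p x).card := by
        simp [φ, p, Finset.prod_ite]
      rw [hx]
      by_cases hxf : x ∈ few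
      · rw [Set.indicator_of_mem hxf, mul_one]
        exact pow_le_pow_of_le_one (by norm_num) (by norm_num) (le_of_lt hxf)
      · rw [Set.indicator_of_notMem hxf, mul_zero]
        positivity
    have h2 := h1.trans (hN ι hι)
    rw [mul_comm] at h2
    exact le_of_mul_le_mul_right h2 (by positivity)
  have hf : ε / 2 ≤ avg fun x =>
      D.indicator (fun _ => 1) x - few.indicator (fun _ => (1 : ℝ)) x := by
    rw [avg_sub]
    change _ ≤ dens D - dens few
    linarith
  obtain ⟨F, hF, hFε⟩ := exists_le_avg_fiber hf p
  have hFn : n ≤ F.card := by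
    by_contra! hlt
    have : avg (fun x : {x // p x = F} =>
        D.indicator (fun _ => 1) x.1 - few.indicator (fun _ => (1 : ℝ)) x.1) ≤ 0 := by
      refine avg_le_of_le fun x => ?_
      have hx : x.1 ∈ few := by simpa [few, x.2] using hlt
      rw [Set.indicator_of_mem hx, sub_nonpos]
      exact Set.indicator_le_self' (fun _ _ => zero_le_one) _
    linarith
  let E : (F → α) → ι → Option α := fun v i => if h : i ∈ F then some (v ⟨i, h⟩) else none
  have hE : ∀ v, p (E v) = F := fun v => by ext i; simp [p, E]
  have hbij : Function.Bijective fun v => (⟨E v, hE v⟩ : {x // p x = F}) := by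
    refine ⟨fun v w hvw => ?_, fun ⟨x, hx⟩ => ?_⟩
    · ext1 ⟨i, hi⟩
      simpa [E, hi] using congr_fun (congr_arg Subtype.val hvw) i
    · have hx' : ∀ i, i ∈ F ↔ x i ≠ none := fun i => by simp [← hx, p]
      refine ⟨fun i => (x i).getD a, Subtype.ext ?_⟩
      ext1 i
      by_cases hi : i ∈ F
      · obtain ⟨b, hb⟩ := Option.ne_none_iff_exists'.1 ((hx' i).1 hi)
        simp [E, hi, hb]
      · simp [E, hi, not_not.1 (mt (hx' i).2 hi)]
  have hdense : ε / 2 ≤ dens {v : F → α | E v ∈ D} := by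
    rw [← avg_equiv (Equiv.ofBijective _ hbij)] at hFε
    refine hFε.trans (avg_mono fun v => ?_)
    have : 0 ≤ few.indicator (fun _ => (1 : ℝ)) (E v) :=
      Set.indicator_nonneg (fun _ _ => zero_le_one) _
    by_cases hv : E v ∈ D <;> simp [hv, this]
  obtain ⟨V, hV⟩ := hn F (by simpa using hFn) _ hdense
  refine ⟨⟨fun i => if h : i ∈ F then (V.idxFun ⟨i, h⟩).map some id else Sum.inl (some a),
    fun e => ?_⟩, fun z => ?_⟩
  · obtain ⟨⟨i, hi⟩, hi'⟩ := V.proper e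
    exact ⟨i, by simp [hi, hi']⟩
  · refine (hD.mem_iff_mem fun i => ?_).1 (hV fun e => (z e).getD a)
    by_cases hi : i ∈ F
    · simp only [E, hi, Subspace.apply_def, dite_true]
      cases V.idxFun ⟨i, hi⟩ <;> simp
    · simp [E, hi, Subspace.apply_def]

end Insensitive

/-! ### Functions with small averages on subspaces -/

theorem dens_prod_sumElim {ι κ β : Type*} [Finite ι] [Finite κ] [Finite β] (A : Set (ι → β))
    (E : Set (κ → β)) :
    dens {z : ι ⊕ κ → β | z ∘ Sum.inl ∈ A ∧ z ∘ Sum.inr ∈ E} = dens A * dens E := by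
  rw [dens_sumElim, mul_comm, dens, dens, ← avg_const_mul]
  congr 1
  ext x
  by_cases hx : x ∈ A <;> simp [hx, dens, avg_zero]

namespace Insensitive

variable {α : Type} {a : α} [Finite α]

theorem avg_le_step {ι κ : Type} [Finite ι] [Finite κ] {m : ℕ} {ε θ c : ℝ} (hε : 0 < ε)
    (hc : 0 ≤ c) (hθ1 : θ ≤ 1)
    (hθ : θ ≤ 1 / Nat.card (ι → Option α) *
      (ε / 2 / (Nat.card (Subspace (Fin m) (Option α) ι) + 1)))
    (hι : ∀ D : Set (ι → Option α), Insensitive a D → ε / 2 ≤ dens D →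
      ∃ V : Subspace (Fin m) (Option α) ι, ∀ x, V x ∈ D)
    (ih : ∀ D : Set (κ → Option α), Insensitive a D → ∀ g : (κ → Option α) → ℝ, (∀ x, g x ≤ 1) →
      (∀ V : Subspace (Fin m) (Option α) κ, avg (fun z => g (V z)) ≤ 0) →
      avg (D.indicator g) ≤ ε + c * dens D)
    {D : Set (ι ⊕ κ → Option α)} (hD : Insensitive a D) {g : (ι ⊕ κ → Option α) → ℝ}
    (hg : ∀ x, g x ≤ 1)
    (hV : ∀ V : Subspace (Fin m) (Option α) (ι ⊕ κ), avg (fun z => g (V z)) ≤ 0) :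
    avg (D.indicator g) ≤ ε + c * (1 - θ) * dens D := by
  have hc' : 0 ≤ c * (1 - θ) := mul_nonneg hc (by linarith)
  by_cases hDε : dens D < ε
  · have h1 := avg_indicator_le_dens hg D
    have h2 := mul_nonneg hc' (dens_nonneg D)
    linarith
  rw [not_lt] at hDε
  obtain ⟨V, hVE⟩ := exists_dense_fibers (A := fun x y => Sum.elim x y ∈ D) hε
    (by rwa [dens_sumElim'] at hDε)
    (fun V : Subspace (Fin m) (Option α) ι => Set.range V)
    fun y hy => by simpa using hι _ (hD.preimage_sumElim' y) hy
  set E : Set (κ → Option α) := {y | ∀ x ∈ Set.range V, Sum.elim x y ∈ D} with hE_def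
  have hE : Insensitive a E := by
    intro y
    refine forall₂_congr fun x hx => ?_
    exact (hD.preimage_sumElim x).mem_iff_mem fun i => by simp
  set R : Set (ι ⊕ κ → Option α) := {z | z ∘ Sum.inl ∈ Set.range V ∧ z ∘ Sum.inr ∈ E}
  have hRD : R ⊆ D := fun z hz => by
    have := hz.2 _ hz.1
    rwa [Sum.elim_comp_inl_inr] at this
  have hR : θ ≤ dens R := by
    rw [dens_prod_sumElim]
    exact hθ.trans (mul_le_mul (one_div_card_le_dens (Set.range_nonempty V)) hVE (by positivity)
      (dens_nonneg _))
  have hsplit : ∀ f : (ι ⊕ κ → Option α) → ℝ,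
      avg (D.indicator f) = avg (R.indicator f) + avg ((D \ R).indicator f) := by
    intro f
    rw [← avg_add]
    congr 1
    ext z
    by_cases hzR : z ∈ R
    · simp [hzR, hRD hzR]
    · by_cases hzD : z ∈ D <;> simp [hzR, hzD]
  have hgR : avg (R.indicator g) ≤ 0 := by
    rw [avg_sumElim, avg_comm]
    refine avg_le_of_le fun y => ?_
    by_cases hy : y ∈ E
    · have h1 : (fun x => R.indicator g (Sum.elim x y)) =
          (Set.range V).indicator fun x => g (Sum.elim x y) := by
        ext x
        by_cases hx : x ∈ Set.range V
        · rw [Set.indicator_of_mem hx, Set.indicator_of_mem]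
          exact ⟨hx, hy⟩
        · rw [Set.indicator_of_notMem hx, Set.indicator_of_notMem]
          exact fun h => hx h.1
      rw [h1, avg_indicator_range V.apply_injective]
      refine mul_nonpos_of_nonneg_of_nonpos (by positivity) ?_
      simpa only [Subspace.horizontal_apply] using hV (V.horizontal y)
    · refine avg_le_of_le fun x => ?_
      rw [Set.indicator_of_notMem]
      exact fun h => hy h.2
  have hgD : avg ((D \ R).indicator g) ≤ ε + c * dens (D \ R) := by
    rw [avg_sumElim, dens_sumElim, ← avg_const_mul, ← avg_const (X := ι → Option α) ε, ← avg_add]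
    refine avg_mono fun x => ?_
    refine ih {y | Sum.elim x y ∈ D \ R} ?_ (fun y => g (Sum.elim x y)) (fun y => hg _)
      fun W => by simpa only [Subspace.vertical_apply] using hV (W.vertical x)
    by_cases hx : x ∈ Set.range V
    · have : {y | Sum.elim x y ∈ D \ R} = {y | Sum.elim x y ∈ D} ∩ Eᶜ := by
        ext y
        refine and_congr_right fun _ => not_congr ⟨fun h => h.2, fun h => ⟨hx, h⟩⟩
      rw [this]
      exact (hD.preimage_sumElim x).inter hE.compl
    · have : {y | Sum.elim x y ∈ D \ R} = {y | Sum.elim x y ∈ D} := by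
        ext y
        exact and_iff_left fun h => hx h.1
      rw [this]
      exact hD.preimage_sumElim x
  have hdens := hsplit fun _ => 1
  change dens D = dens R + dens (D \ R) at hdens
  have h1 : dens (D \ R) ≤ (1 - θ) * dens D := by
    rcases le_or_gt θ 0 with h | h
    · nlinarith [dens_nonneg D, dens_nonneg R]
    · nlinarith [dens_le_one D, dens_nonneg D]
  have h2 := mul_le_mul_of_nonneg_left h1 hc
  rw [hsplit g]
  linarith

/-- A function whose averages on all subspaces of a given dimension are nonpositive has a small
average on insensitive sets. -/
theorem avg_le [Nonempty α] (h : ∀ δ > 0, DensityHJ α δ) (a : α) (m : ℕ) {ε : ℝ} (hε : 0 < ε) :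
    ∃ N : ℕ, ∀ (ι : Type) [Finite ι], N ≤ Nat.card ι →
      ∀ D : Set (ι → Option α), Insensitive a D → ∀ g : (ι → Option α) → ℝ, (∀ x, g x ≤ 1) →
        (∀ V : Subspace (Fin m) (Option α) ι, avg (fun z => g (V z)) ≤ 0) →
        avg (D.indicator g) ≤ ε := by
  obtain ⟨M, hM⟩ := exists_subspace h a m (ε := ε / 2 / 2) (by positivity)
  set θ₀ : ℝ := 1 / Nat.card (Fin M → Option α) *
    (ε / 2 / 2 / (Nat.card (Subspace (Fin m) (Option α) (Fin M)) + 1))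
  have hcard : 0 < Nat.card (Fin M → Option α) := Nat.card_pos
  have hθ₀ : 0 < θ₀ := by positivity
  set θ : ℝ := min θ₀ 1
  have hθ : 0 < θ := lt_min hθ₀ one_pos
  have hθ1 : θ ≤ 1 := min_le_right _ _
  obtain ⟨r, hr⟩ := exists_pow_lt_of_lt_one (half_pos hε) (show 1 - θ < 1 by linarith)
  have key : ∀ (r : ℕ) (ι : Type) [Finite ι], r * M ≤ Nat.card ι →
      ∀ D : Set (ι → Option α), Insensitive a D → ∀ g : (ι → Option α) → ℝ, (∀ x, g x ≤ 1) →
        (∀ V : Subspace (Fin m) (Option α) ι, avg (fun z => g (V z)) ≤ 0) →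
        avg (D.indicator g) ≤ ε / 2 + (1 - θ) ^ r * dens D := by
    intro r
    induction r with
    | zero =>
      intro ι _ _ D _ g hg _
      have := avg_indicator_le_dens hg D
      rw [pow_zero]
      linarith
    | succ r ih =>
      intro ι _ hι D hD g hg hV
      rw [Nat.succ_mul, add_comm] at hι
      obtain ⟨k, hk, ⟨e⟩⟩ := exists_sum_equiv hι
      have := avg_le_step (half_pos hε) (pow_nonneg (sub_nonneg.2 hθ1) r) hθ1 (min_le_left _ _)
        (hM (Fin M) (by simp)) (ih (Fin k) (by simpa using hk)) (hD.preimage_reindex e.symm)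
        (g := fun x => g fun i => x (e.symm i)) (fun x => hg _) fun V => by
          simpa only [Subspace.reindex_refl_apply] using
            hV (V.reindex (Equiv.refl _) (Equiv.refl _) e)
      rw [dens_comp_symm, ← pow_succ] at this
      rw [← avg_equiv (e.arrowCongr (Equiv.refl (Option α)))]
      exact this
  refine ⟨r * M, fun ι _ hι D hD g hg hV => (key r ι hι D hD g hg hV).trans ?_⟩
  have h1 := mul_le_mul hr.le (dens_le_one D) (dens_nonneg D) (half_pos hε).le
  linarith

/-- A function whose averages on all subspaces of a given dimension are nonpositive has a small
average on the complement of an intersection of insensitive sets. -/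
theorem avg_le_exists [Nonempty α] (h : ∀ δ > 0, DensityHJ α δ) (L : List α) :
    ∀ (m : ℕ) (ε : ℝ), 0 < ε → ∃ N : ℕ, ∀ (ι : Type) [Finite ι], N ≤ Nat.card ι →
      ∀ D : α → Set (ι → Option α), (∀ a, Insensitive a (D a)) →
        ∀ g : (ι → Option α) → ℝ, (∀ x, g x ≤ 1) →
          (∀ V : Subspace (Fin m) (Option α) ι, avg (fun z => g (V z)) ≤ 0) →
          avg ({x | ∃ a ∈ L, x ∉ D a}.indicator g) ≤ ε := by
  induction L with
  | nil =>
    intro m ε hε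
    refine ⟨0, fun ι _ _ D _ g _ _ => ?_⟩
    simpa [avg_zero] using hε.le
  | cons a L ih =>
    intro m ε hε
    obtain ⟨N₁, h₁⟩ := avg_le h a m (ε := ε / 4) (by positivity)
    obtain ⟨N₂, h₂⟩ := ih m (ε / 2) (by positivity)
    obtain ⟨N₃, h₃⟩ := avg_le h a N₂ (ε := ε / 4) (by positivity)
    refine ⟨max N₁ N₃, fun ι _ hι D hD g hg hV => ?_⟩
    have k₁ := h₁ ι ((le_max_left _ _).trans hι) _ (hD a).compl g hg hV
    set U : Set (ι → Option α) := {x | ∃ a ∈ L, x ∉ D a}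
    have k₃ := h₃ ι ((le_max_right _ _).trans hι) _ (hD a) (fun x => U.indicator g x - ε / 2)
      (fun x => by
        have : U.indicator g x ≤ 1 := by
          by_cases hx : x ∈ U <;> simp [hx, hg]
        linarith)
      fun V => by
        rw [avg_sub, avg_const, sub_nonpos]
        refine h₂ (Fin N₂) (by simp) (fun a => {x | V x ∈ D a})
          (fun a => (hD a).preimage_subspace V) (fun z => g (V z)) (fun z => hg _) fun W => ?_
        simpa only [Subspace.comp_apply] using hV (V.comp W)
    have hle : avg ({x | ∃ b ∈ a :: L, x ∉ D b}.indicator g) ≤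
        avg fun x => (D a)ᶜ.indicator g x +
          ((D a).indicator (fun x => U.indicator g x - ε / 2) x + ε / 2) := by
      refine avg_mono fun x => ?_
      by_cases hx : x ∈ D a
      · have : x ∈ {x | ∃ b ∈ a :: L, x ∉ D b} ↔ x ∈ U := by simp [hx, U]
        by_cases hU : x ∈ U
        · rw [Set.indicator_of_mem (this.2 hU)]
          simp [hx, hU]
        · rw [Set.indicator_of_notMem (mt this.1 hU)]
          simp [hx, hU]
      · rw [Set.indicator_of_mem (show x ∈ {x | ∃ b ∈ a :: L, x ∉ D b} from ⟨a, by simp, hx⟩)]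
        simp [hx, (half_pos hε).le]
    rw [avg_add, avg_add, avg_const] at hle
    change _ ≤ avg ((D a)ᶜ.indicator g) + (avg ((D a).indicator _) + _) at hle
    linarith

end Insensitive

/-! ### The density Hales–Jewett theorem -/

theorem le_card_mul_avg {X : Type*} [Finite X] {f : X → ℝ} (h : ∀ x, 0 ≤ f x) (x : X) :
    f x ≤ Nat.card X * avg f := by
  cases nonempty_fintype X
  have : Nonempty X := ⟨x⟩
  rw [avg_eq_sum, Nat.card_eq_fintype_card, mul_div_cancel₀ _ (by positivity)]
  exact Finset.single_le_sum (fun y _ => h y) (Finset.mem_univ x)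

namespace Combinatorics

variable {α : Type}

theorem Subspace.extend_some_getD {η ι : Type*} (V : Subspace η α ι) (w : η → Option α) (a : α) :
    V.extend (fun e => some ((w e).getD a)) = fun i => some ((V.extend w i).getD a) := by
  ext1 i
  rw [extend_apply, extend_apply]
  cases V.idxFun i <;> simp

/-- If all sections of `A` are dense, then in some subspace every word with a variable gives a line
contained in a positive proportion of the fibres of `A`. -/
theorem exists_subspace_dense_lines (α η : Type) [Finite α] [Nonempty α] [Finite η] {M : ℕ} {c : ℝ}
    (hc : 0 < c) (hM : ∀ A : Set (Fin M → α), c / 2 ≤ dens A → ∃ l : Line α (Fin M), ∀ a, l a ∈ A) :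
    ∃ (ι : Type) (_ : Finite ι), ∀ (κ : Type) [Finite κ] (A : Set (ι ⊕ κ → Option α)),
      (∀ t, c ≤ dens {y | Sum.elim t y ∈ A}) → ∃ V : Subspace (Fin M ⊕ η) α ι,
        ∀ w : Fin M ⊕ η → Option α, (∃ e, w e = none) → c / 2 / (Nat.card (Line α (Fin M)) + 1) ≤
          dens {y | ∀ a, Sum.elim (V.extend fun e => some ((w e).getD a)) y ∈ A} := by
  obtain ⟨ι, hι, h⟩ := exists_subspace_mono_lines α Prop (Fin M ⊕ η)
  refine ⟨ι, hι, fun κ _ A hA => ?_⟩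
  obtain ⟨V, P, hV⟩ := h fun w => c / 2 / (Nat.card (Line α (Fin M)) + 1) ≤
    dens {y : κ → Option α | ∀ a, Sum.elim (fun i => some ((w i).getD a)) y ∈ A}
  let a₀ : α := Classical.arbitrary α
  have hdense : c ≤ avg fun y : κ → Option α => dens {x : Fin M → α |
      Sum.elim (V.extend (Sum.elim (fun i => some (x i)) fun _ => some a₀)) y ∈ A} := by
    simp only [dens]
    refine le_trans ?_ (avg_comm _).le
    rw [← avg_const (X := Fin M → α) c]
    exact avg_mono fun x => hA _
  obtain ⟨l, hl⟩ := exists_dense_fibers hc hdense (fun l : Line α (Fin M) => Set.range l)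
    fun y hy => by simpa using hM _ hy
  have hP := hV (Sum.elim l.idxFun fun _ => some a₀)
    (by obtain ⟨i, hi⟩ := l.proper; exact ⟨Sum.inl i, hi⟩)
  refine ⟨V, fun w hw => ?_⟩
  simp only [Subspace.extend_some_getD]
  refine (hV w hw).trans hP.symm ▸ hl.trans (dens_mono fun y hy a => ?_)
  rw [← Subspace.extend_some_getD]
  convert hy (l a) ⟨a, rfl⟩ using 3
  ext1 (i | i) <;> simp [Line.coe_apply]

theorem le_of_forall_line_notMem {η ι κ : Type} [Finite α] [Nonempty α] [Finite η] [Finite ι]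
    [Finite κ] {V : Subspace η α ι} {A : Set (ι ⊕ κ → Option α)}
    (hfree : ¬∃ l : Line (Option α) (ι ⊕ κ), ∀ a, l a ∈ A) {m : ℕ} {c d γ θ : ℝ} (hd : 0 ≤ d)
    (hA : ∀ t, c ≤ dens {y | Sum.elim t y ∈ A})
    (hV : ∀ w : η → Option α, (∃ e, w e = none) →
      θ ≤ dens {y | ∀ a, Sum.elim (V.extend fun e => some ((w e).getD a)) y ∈ A})
    (hη : ∀ D : α → Set (η → Option α), (∀ a, Insensitive a (D a)) →
      ∀ g : (η → Option α) → ℝ, (∀ x, g x ≤ 1) →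
        (∀ W : Subspace (Fin m) (Option α) η, avg (fun z => g (W z)) ≤ 0) →
        avg ({x | ∃ a, x ∉ D a}.indicator g) ≤ γ)
    (hm : ∀ W : Subspace (Fin m) (Option α) (ι ⊕ κ), dens {z | W z ∈ A} ≤ d) :
    c ≤ γ + d * (1 - θ * (1 - dens {x : η → Option α | ∀ e, x e ≠ none})) +
      dens {x : η → Option α | ∀ e, x e ≠ none} := by
  set S : Set (η → Option α) := {x | ∀ e, x e ≠ none}
  let D : (κ → Option α) → α → Set (η → Option α) := fun y a =>
    {x | Sum.elim (V.extend fun e => some ((x e).getD a)) y ∈ A}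
  let B : (κ → Option α) → Set (η → Option α) := fun y => {x | Sum.elim (V.extend x) y ∈ A}
  have hD : ∀ y a, Insensitive a (D y a) := fun y a x => by simp [D]
  have hBD : ∀ y x, x ∈ B y → (∀ a, x ∈ D y a) → x ∈ S := by
    intro y x hx hxD e he
    let l : Line (Option α) η := ⟨fun e => (x e).map some, ⟨e, by simp [he]⟩⟩
    refine hfree ⟨(V.extend.horizontal y).compLine l, fun b => ?_⟩
    rw [Subspace.compLine_apply, Subspace.horizontal_apply]
    cases b with
    | none =>
      convert (show Sum.elim (V.extend x) y ∈ A from hx) using 3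
      ext1 e
      rw [Line.coe_apply]
      cases h : x e <;> simp [l, h]
    | some a =>
      convert (show Sum.elim (V.extend fun e => some ((x e).getD a)) y ∈ A from hxD a) using 3
      ext1 e
      rw [Line.coe_apply]
      cases h : x e <;> simp [l, h]
  have hfib : ∀ y, dens (B y) ≤ γ + d * (1 - dens {x | ∀ a, x ∈ D y a}) + dens S := by
    intro y
    have h1 := hη (D y) (hD y) (fun x => (B y).indicator (fun _ => 1) x - d)
      (fun x => by
        have : (B y).indicator (fun _ => (1 : ℝ)) x ≤ 1 :=
          Set.indicator_le_self' (fun _ _ => zero_le_one) _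
        linarith)
      fun W => by
        rw [avg_sub, avg_const, sub_nonpos]
        refine le_trans (le_of_eq ?_) (hm ((V.extend.comp W).horizontal y))
        simp only [Subspace.horizontal_apply, Subspace.comp_apply]
        rfl
    have hcompl : {x | ∃ a, x ∉ D y a} = {x | ∀ a, x ∈ D y a}ᶜ := by
      ext x
      simp
    rw [hcompl] at h1
    rw [← dens_compl]
    set U : Set (η → Option α) := {x | ∀ a, x ∈ D y a}
    have h2 : dens (B y) ≤ avg fun x => (Uᶜ.indicator (fun x => (B y).indicator (fun _ => 1) x - d) x
        + d * Uᶜ.indicator (fun _ => 1) x) + S.indicator (fun _ => 1) x := by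
      refine avg_mono fun x => ?_
      have hS : 0 ≤ S.indicator (fun _ => (1 : ℝ)) x :=
        Set.indicator_nonneg (fun _ _ => zero_le_one) _
      by_cases hU : x ∈ U
      · by_cases hB : x ∈ B y
        · simp [hU, hB, hBD y x hB hU]
        · simp [hU, hB, hS]
      · simp [hU, hS]
    rw [avg_add, avg_add, avg_const_mul] at h2
    change _ ≤ avg (Uᶜ.indicator _) + d * dens Uᶜ + dens S at h2
    linarith
  have hlow : c ≤ avg fun y => dens (B y) := by
    simp only [dens]
    refine le_trans ?_ (avg_comm _).le
    rw [← avg_const (X := η → Option α) c]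
    exact avg_mono fun x => hA _
  have hgood : θ * (1 - dens S) ≤ avg fun y => dens {x | ∀ a, x ∈ D y a} := by
    rw [← dens_compl, dens, ← avg_const_mul]
    simp only [dens]
    refine le_trans (avg_mono fun x => ?_) (avg_comm _).le
    change _ ≤ dens {y | ∀ a, x ∈ D y a}
    by_cases hx : x ∈ S
    · simpa [hx] using dens_nonneg {y | ∀ a, x ∈ D y a}
    · have hx' : ∃ e, x e = none := by simpa [S] using hx
      rw [Set.indicator_of_mem (show x ∈ Sᶜ from hx), mul_one]
      exact hV x hx'
  have hup := avg_mono hfib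
  rw [avg_add, avg_add, avg_const_mul, avg_sub, avg_const, avg_const, avg_const] at hup
  have := mul_le_mul_of_nonneg_left hgood hd
  linarith

end Combinatorics

theorem DensityHJ.mono {α : Type} {δ ε : ℝ} (h : DensityHJ α δ) (hδε : δ ≤ ε) :
    DensityHJ α ε := by
  obtain ⟨n, hn⟩ := h
  exact ⟨n, fun ι _ hι A hA => hn ι hι A (hδε.trans hA)⟩

/-- The induction step of the density Hales–Jewett theorem. -/
theorem densityHJ_option {α : Type} [Finite α] [Nonempty α] (h : ∀ δ > 0, DensityHJ α δ) :
    ∀ δ > 0, DensityHJ (Option α) δ := by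
  intro δ₁ hδ₁
  by_contra hfail
  set S : Set ℝ := {δ | ¬DensityHJ (Option α) δ}
  have hS1 : ∀ δ ∈ S, δ ≤ 1 := by
    intro δ hδ
    by_contra! hlt
    exact hδ ⟨0, fun ι _ _ A hA => absurd (dens_le_one A) (by linarith)⟩
  have hSb : BddAbove S := ⟨1, hS1⟩
  have hSne : S.Nonempty := ⟨δ₁, hfail⟩
  set δ₀ := sSup S
  have hδ₀ : 0 < δ₀ := hδ₁.trans_le (le_csSup hSb hfail)
  have hδ₀1 : δ₀ ≤ 1 := csSup_le hSne hS1
  have hhold : ∀ ε > 0, DensityHJ (Option α) (δ₀ + ε) := by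
    intro ε hε
    by_contra hcon
    have := le_csSup hSb hcon
    linarith
  have hfails : ∀ ε > 0, ¬DensityHJ (Option α) (δ₀ - ε) := by
    intro ε hε hcon
    obtain ⟨δ, hδ, hlt⟩ := exists_lt_of_lt_csSup hSne (show δ₀ - ε < δ₀ by linarith)
    exact hδ (hcon.mono hlt.le)
  obtain ⟨M, hM⟩ := h (δ₀ / 2 / 2) (by positivity)
  set θ : ℝ := δ₀ / 2 / 2 / (Nat.card (Line α (Fin M)) + 1) with hθ_def
  have hθ : 0 < θ := by positivity
  have hθ1 : θ ≤ 1 := by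
    rw [hθ_def, div_le_one (by positivity)]
    have : (0 : ℝ) ≤ Nat.card (Line α (Fin M)) := by positivity
    linarith
  set γ : ℝ := δ₀ * θ / 16 with hγ_def
  have hγ : 0 < γ := by positivity
  have hγδ : γ ≤ δ₀ / 2 := by nlinarith
  obtain ⟨m, hm⟩ := hhold γ hγ
  obtain ⟨N₁, hN₁⟩ := Insensitive.avg_le_exists h (L := (@Finset.univ α (Fintype.ofFinite α)).toList)
    m γ hγ
  let φ : Option α → ℝ := fun b => if b = none then 0 else 1
  obtain ⟨N₂, hN₂⟩ := exists_forall_avg_prod_le (φ := φ)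
    (fun b => by dsimp only [φ]; split_ifs <;> norm_num)
    (fun b => by dsimp only [φ]; split_ifs <;> norm_num) (b₀ := none)
    (by dsimp only [φ]; rw [if_pos rfl]; norm_num) (ε := min γ (1 / 2)) (by positivity)
  obtain ⟨ι, _, hι⟩ := exists_subspace_dense_lines α (Fin (max N₁ N₂)) (half_pos hδ₀)
    (hM (Fin M) (by simp))
  set K : ℝ := (Nat.card (ι → Option α) : ℝ) with hK_def
  have hK : 0 < K := Nat.cast_pos.2 Nat.card_pos
  obtain ⟨n, hn⟩ := hhold (γ / (2 * K)) (by positivity)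
  refine hfails (γ / (2 * K)) (by positivity) ⟨Nat.card ι + n, fun ι' _ hι' A' hA' => ?_⟩
  by_contra hfree'
  obtain ⟨k, hk, ⟨e'⟩⟩ := exists_sum_equiv hι'
  let e : ι ⊕ Fin k ≃ ι' := ((Finite.equivFin ι).sumCongr (Equiv.refl _)).trans e'
  rw [← dens_comp_symm e] at hA'
  set A : Set (ι ⊕ Fin k → Option α) := {x | (fun i => x (e.symm i)) ∈ A'}
  have hfree : ¬∃ l : Line (Option α) (ι ⊕ Fin k), ∀ a, l a ∈ A := by
    rintro ⟨l, hl⟩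
    refine hfree' ⟨⟨fun i => l.idxFun (e.symm i), ?_⟩, hl⟩
    obtain ⟨i, hi⟩ := l.proper
    exact ⟨e i, by simpa using hi⟩
  have hsec : ∀ t, dens {y | Sum.elim t y ∈ A} ≤ δ₀ + γ / (2 * K) := by
    intro t
    by_contra! hlt
    obtain ⟨l, hl⟩ := hn (Fin k) (by simpa using hk) _ hlt.le
    exact hfree ⟨l.vertical t, fun a => by rw [Line.vertical_apply]; exact hl a⟩
  have hsec' : ∀ t, δ₀ - γ ≤ dens {y | Sum.elim t y ∈ A} := by
    intro t
    have h1 := le_card_mul_avg (fun t => sub_nonneg.2 (hsec t)) t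
    rw [avg_sub, avg_const, ← dens_sumElim, ← hK_def] at h1
    have h2 : K * (δ₀ + γ / (2 * K) - dens A) ≤ K * (2 * (γ / (2 * K))) := by
      gcongr
      linarith
    have h3 : K * (2 * (γ / (2 * K))) = γ := by field_simp
    have h4 : 0 < γ / (2 * K) := by positivity
    linarith
  obtain ⟨V, hV⟩ := hι (Fin k) A fun t => le_trans (by linarith) (hsec' t)
  set T : Set (Fin M ⊕ Fin (max N₁ N₂) → Option α) := {x | ∀ e, x e ≠ none}
  set ν := dens T
  have hν : ν ≤ min γ (1 / 2) := by
    refine le_trans (avg_mono fun x => ?_) (hN₂ (Fin M ⊕ Fin (max N₁ N₂)) ?_)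
    · by_cases hx : x ∈ T
      · rw [Set.indicator_of_mem hx, Finset.prod_eq_one fun e _ => by simp [φ, hx e]]
      · rw [Set.indicator_of_notMem hx]
        exact Finset.prod_nonneg fun e _ => by dsimp only [φ]; split_ifs <;> norm_num
    · rw [Nat.card_sum, Nat.card_fin, Nat.card_fin]
      exact (le_max_right _ _).trans (Nat.le_add_left _ _)
  have key := le_of_forall_line_notMem hfree (d := δ₀ + γ) (by positivity) hsec' hV
    (fun D hD g hg hW => by
      have := hN₁ (Fin M ⊕ Fin (max N₁ N₂)) (by
        rw [Nat.card_sum, Nat.card_fin, Nat.card_fin]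
        exact (le_max_left _ _).trans (Nat.le_add_left _ _)) D hD g hg hW
      simpa using this)
    fun W => by
      by_contra! hlt
      obtain ⟨l, hl⟩ := hm (Fin m) (by simp) _ hlt.le
      exact hfree ⟨W.compLine l, fun a => by rw [Subspace.compLine_apply]; exact hl a⟩
  change _ ≤ γ + (δ₀ + γ) * (1 - θ * (1 - ν)) + ν at key
  have hν1 := hν.trans (min_le_left _ _)
  have hν2 := hν.trans (min_le_right _ _)
  have h1 : δ₀ * (θ * (1 / 2)) ≤ (δ₀ + γ) * (θ * (1 - ν)) := by
    gcongr <;> linarith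
  nlinarith [mul_pos hδ₀ hθ]

theorem densityHJ_congr {α β : Type} (e : α ≃ β) {δ : ℝ} (h : DensityHJ α δ) : DensityHJ β δ := by
  obtain ⟨n, hn⟩ := h
  refine ⟨n, fun ι _ hι A hA => ?_⟩
  obtain ⟨l, hl⟩ := hn ι hι {x | (fun i => e (x i)) ∈ A}
    (by rwa [← dens_preimage_equiv ((Equiv.refl ι).arrowCongr e)] at hA)
  refine ⟨⟨fun i => (l.idxFun i).map e, ?_⟩, fun b => ?_⟩
  · obtain ⟨i, hi⟩ := l.proper
    exact ⟨i, by simp [hi]⟩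
  · refine Eq.mp (congr_arg (· ∈ A) ?_) (hl (e.symm b))
    ext1 i
    simp only [Line.coe_apply]
    cases l.idxFun i <;> simp

/-- The density Hales–Jewett theorem. -/
theorem densityHJ (α : Type) [Finite α] [Nonempty α] : ∀ δ > 0, DensityHJ α δ := by
  suffices h : Nonempty α → ∀ δ > 0, DensityHJ α δ from h inferInstance
  refine Finite.induction_empty_option (P := fun α => Nonempty α → ∀ δ > 0, DensityHJ α δ)
    ?_ ?_ ?_ α
  · exact fun e h hne δ hδ => densityHJ_congr e (h (e.nonempty_congr.2 hne) δ hδ)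
  · exact fun h => h.elim PEmpty.elim
  · intro α _ h _
    cases isEmpty_or_nonempty α with
    | inl hα =>
      refine fun δ hδ => ⟨1, fun ι _ hι A hA => ?_⟩
      obtain ⟨x, hx⟩ := nonempty_of_dens_pos (hδ.trans_le hA)
      have hne : Nonempty ι := (Nat.card_pos_iff.1 hι).1
      refine ⟨⟨fun _ => none, ⟨Classical.arbitrary ι, rfl⟩⟩, fun a => ?_⟩
      refine Eq.mp (congr_arg (· ∈ A) ?_) hx
      ext1 i
      exact Subsingleton.elim _ _
    | inr hα => exact densityHJ_option (h hα)

/-! ### Szemerédi's theorem -/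

theorem card_filter_Icc_le (C : Set ℕ) (N s : ℕ) :
    ((Finset.Icc 1 N).filter (fun n => n ∈ C)).card ≤
      s + ((Finset.Icc 1 N).filter (fun n => n + s ∈ C)).card := by
  have h : (Finset.Icc 1 N).filter (fun n => n ∈ C) ⊆ Finset.Icc 1 s ∪
      ((Finset.Icc 1 N).filter (fun n => n + s ∈ C)).image (· + s) := by
    intro n hn
    simp only [Finset.mem_filter, Finset.mem_Icc, Finset.mem_union, Finset.mem_image] at hn ⊢
    by_cases hs : n ≤ s
    · exact Or.inl ⟨hn.1.1, hs⟩
    · refine Or.inr ⟨n - s, ⟨⟨by omega, by omega⟩, ?_⟩, by omega⟩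
      rw [Nat.sub_add_cancel (by omega)]
      exact hn.2
  refine (Finset.card_le_card h).trans ((Finset.card_union_le _ _).trans ?_)
  rw [Nat.card_Icc, Nat.add_sub_cancel]
  exact Nat.add_le_add_left Finset.card_image_le s

theorem dens_Icc (C : Set ℕ) (N s : ℕ) :
    dens {b : Finset.Icc 1 N | b.1 + s ∈ C} =
      ((Finset.Icc 1 N).filter (fun n => n + s ∈ C)).card / N := by
  rw [dens, avg_eq_sum, Fintype.card_coe, Nat.card_Icc, Nat.add_sub_cancel]
  congr 1
  rw [Finset.card_filter, Nat.cast_sum, ← Finset.sum_coe_sort (Finset.Icc 1 N)]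
  refine Finset.sum_congr rfl fun b _ => ?_
  by_cases hb : b.1 + s ∈ C <;> simp [hb]

/-- The sum of the entries along a combinatorial line is an arithmetic progression. -/
theorem Combinatorics.Line.exists_sum_eq {k n : ℕ} (l : Line (Fin (k + 1)) (Fin n)) :
    ∃ s d : ℕ, 0 < d ∧ ∀ i, ∑ j, (l i j).val = s + i.val * d := by
  refine ⟨∑ j, (l.idxFun j).elim 0 Fin.val, ∑ j, (l.idxFun j).elim 1 fun _ => 0, ?_, ?_⟩
  · obtain ⟨j, hj⟩ := l.proper
    exact Finset.sum_pos' (M := ℕ) (fun _ _ => Nat.zero_le _) ⟨j, Finset.mem_univ j, by simp [hj]⟩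
  · intro i
    rw [Finset.mul_sum, ← Finset.sum_add_distrib]
    refine Finset.sum_congr rfl fun j _ => ?_
    rw [Line.coe_apply]
    cases l.idxFun j <;> simp

/-- **Szemerédi's theorem.** Every set of natural numbers with positive upper density
contains arbitrarily long arithmetic progressions. -/
theorem szemeredi (C : Set ℕ) (hC : 0 < upperDensity C) :
    ∀ k : ℕ, ∃ a n : ℕ, 0 < a ∧ 0 < n ∧ ∀ i ≤ k, a + i * n ∈ C := by
  intro k
  set δ := upperDensity C / 2 with hδ_def
  have hδ : 0 < δ := half_pos hC
  obtain ⟨n, hn⟩ := densityHJ (Fin (k + 1)) (δ / 4) (by positivity)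
  have hfreq := frequently_lt_of_lt_limsup (f := atTop)
    (u := fun N : ℕ => (((Finset.Icc 1 N).filter (fun n => n ∈ C)).card : ℝ) / N) (b := δ)
    (isCoboundedUnder_le_of_le atTop (x := 0) fun N => by positivity) (half_lt_self hC)
  obtain ⟨N₀, hN₀⟩ := exists_nat_gt (n * k / (δ / 2) : ℝ)
  obtain ⟨N, hN, hNδ⟩ := hfreq.forall_exists_of_atTop (max N₀ 1)
  have hN1 : 1 ≤ N := (le_max_right _ _).trans hN
  have hNpos : (0 : ℝ) < N := by exact_mod_cast hN1
  have hNk : (n * k : ℝ) ≤ δ / 2 * N := by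
    have h1 : (N₀ : ℝ) ≤ N := by exact_mod_cast (le_max_left _ _).trans hN
    have h2 := (div_lt_iff₀ (half_pos hδ)).1 (hN₀.trans_le h1)
    linarith
  rw [lt_div_iff₀ hNpos] at hNδ
  have : Nonempty (Finset.Icc 1 N) := ⟨⟨1, by simpa using hN1⟩⟩
  have hx : ∀ x : Fin n → Fin (k + 1),
      δ / 2 ≤ dens {b : Finset.Icc 1 N | b.1 + ∑ j, (x j).val ∈ C} := by
    intro x
    have hs : ∑ j, (x j).val ≤ n * k := by
      simpa using Finset.sum_le_card_nsmul Finset.univ (fun j => (x j).val) k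
        fun j _ => Nat.lt_succ_iff.1 (x j).2
    have hs' : ((∑ j, (x j).val : ℕ) : ℝ) ≤ n * k := by exact_mod_cast hs
    have hcard := card_filter_Icc_le C N (∑ j, (x j).val)
    rw [dens_Icc, le_div_iff₀ hNpos]
    have hcard' := (Nat.cast_le (α := ℝ)).2 hcard
    rw [Nat.cast_add] at hcard'
    linarith
  obtain ⟨b, hb⟩ : ∃ b : Finset.Icc 1 N,
      δ / 4 ≤ dens {x : Fin n → Fin (k + 1) | b.1 + ∑ j, (x j).val ∈ C} := by
    by_contra! hlt
    have h1 := avg_le_of_le fun b => (hlt b).le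
    have h2 := (avg_const (X := Fin n → Fin (k + 1)) (δ / 2)).symm.le.trans (avg_mono hx)
    have h3 := h2.trans (avg_comm _).le
    change _ ≤ avg fun b : Finset.Icc 1 N =>
      dens {x : Fin n → Fin (k + 1) | b.1 + ∑ j, (x j).val ∈ C} at h3
    linarith
  obtain ⟨l, hl⟩ := hn (Fin n) (by simp) _ hb
  obtain ⟨s, d, hd, hs⟩ := l.exists_sum_eq
  refine ⟨b.1 + s, d, ?_, hd, fun i hi => ?_⟩
  · have := (Finset.mem_Icc.1 b.2).1
    omega
  · have := hl ⟨i, Nat.lt_succ_iff.2 hi⟩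
    rw [Set.mem_ofPred_eq, hs] at this
    rwa [add_assoc]
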